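/- Let T¹ ∈ ℝ with T¹ ≠ 0, and consider on ℝ² the connection with constant Christoffel symbols Γ_{11}¹ = −1, Γ_{12}¹ = T¹, Γ_{21}¹ = −T¹, Γ_{22}² = 1, and all other Γ_{ij}^k = 0 (the model M₂⁶(T¹,0)). Then a smooth vector field X on ℝ² is an affine Killing vector field for this connection if and only if X lies in the ℝ-linear span of the four vector fields (1,0), (e^{x¹}, 0), (e^{x¹+x²}, 0), and (0,1). -/

import Mathlib

open Real

/-- The partial derivative `∂f/∂x^i` of a function on `ℝ²` (points are `Fin 2 → ℝ`). -/
noncomputable def pd (f : (Fin 2 → ℝ) → ℝ) (i : Fin 2) (p : Fin 2 → ℝ) : ℝ :=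
  fderiv ℝ f p (Pi.single i 1)

/-- The affine Killing operator
`K^Γ_{ij}^k(v) = ∂_i∂_j v^k + v^l ∂_l Γ_{ij}^k − Γ_{ij}^l ∂_l v^k + Γ_{il}^k ∂_j v^l + Γ_{lj}^k ∂_i v^l`
(summation over `l`). -/
noncomputable def killingOp (Γ : Fin 2 → Fin 2 → Fin 2 → (Fin 2 → ℝ) → ℝ)
    (v : Fin 2 → (Fin 2 → ℝ) → ℝ) (i j k : Fin 2) (p : Fin 2 → ℝ) : ℝ :=
  pd (fun q => pd (v k) j q) i p
    + (∑ l : Fin 2, v l p * pd (Γ i j k) l p)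
    - (∑ l : Fin 2, Γ i j l p * pd (v k) l p)
    + (∑ l : Fin 2, Γ i l k p * pd (v l) j p)
    + (∑ l : Fin 2, Γ l j k p * pd (v l) i p)

/-- `v` is an affine Killing vector field for the connection `Γ` on `U`:
all eight affine Killing equations hold on `U`. -/
def IsAffineKilling (U : Set (Fin 2 → ℝ))
    (Γ : Fin 2 → Fin 2 → Fin 2 → (Fin 2 → ℝ) → ℝ)
    (v : Fin 2 → (Fin 2 → ℝ) → ℝ) : Prop :=
  ∀ i j k : Fin 2, ∀ p ∈ U, killingOp Γ v i j k p = 0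

theorem ContDiff.pd {f : (Fin 2 → ℝ) → ℝ} (hf : ContDiff ℝ (⊤ : ℕ∞) f) (i : Fin 2) :
    ContDiff ℝ (⊤ : ℕ∞) (_root_.pd f i) :=
  (hf.fderiv_right (m := (⊤ : ℕ∞)) (by simp)).clm_apply contDiff_const

theorem pd_comm {f : (Fin 2 → ℝ) → ℝ} (hf : ContDiff ℝ (⊤ : ℕ∞) f) (i j : Fin 2)
    (p : Fin 2 → ℝ) : pd (pd f i) j p = pd (pd f j) i p := by
  have hd : DifferentiableAt ℝ (fderiv ℝ f) p :=
    ((hf.fderiv_right (m := (⊤ : ℕ∞)) (by simp)).differentiable (by simp)) p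
  have key : ∀ i j : Fin 2, pd (pd f i) j p =
      fderiv ℝ (fderiv ℝ f) p (Pi.single j 1) (Pi.single i 1) := fun i j => by
    have h := hd.hasFDerivAt.clm_apply
      (hasFDerivAt_const (Pi.single i 1 : Fin 2 → ℝ) p)
    have h' : fderiv ℝ (pd f i) p = _ := h.fderiv
    rw [pd, h']
    simp
  rw [key, key]
  exact (hf.contDiffAt.isSymmSndFDerivAt (by
    rw [minSmoothness_of_isRCLikeNormedField]
    exact WithTop.coe_le_coe.2 le_top)).eq _ _

theorem pd_sub {f g : (Fin 2 → ℝ) → ℝ} (hf : Differentiable ℝ f) (hg : Differentiable ℝ g)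
    (i : Fin 2) (p : Fin 2 → ℝ) : pd (fun q => f q - g q) i p = pd f i p - pd g i p := by
  simp only [pd]
  rw [fderiv_fun_sub (hf p) (hg p)]
  rfl

theorem fderiv_apply_eq_pd (f : (Fin 2 → ℝ) → ℝ) (p x : Fin 2 → ℝ) :
    fderiv ℝ f p x = x 0 * pd f 0 p + x 1 * pd f 1 p := by
  have hx : x = x 0 • (Pi.single 0 1 : Fin 2 → ℝ) + x 1 • (Pi.single 1 1 : Fin 2 → ℝ) := by
    ext i; fin_cases i <;> simp
  conv_lhs => rw [hx]
  simp [pd]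

/-- A function whose partial derivatives are constant multiples of itself is exponential. -/
theorem eq_mul_exp_of_pd {w : (Fin 2 → ℝ) → ℝ} (hw : Differentiable ℝ w) {α β : ℝ}
    (h0 : ∀ p, pd w 0 p = α * w p) (h1 : ∀ p, pd w 1 p = β * w p) (p : Fin 2 → ℝ) :
    w p = w 0 * exp (α * p 0 + β * p 1) := by
  have hE : ∀ q : Fin 2 → ℝ, HasFDerivAt (fun q : Fin 2 → ℝ => exp (-(α * q 0 + β * q 1)))
      (exp (-(α * q 0 + β * q 1)) • -(α • ContinuousLinearMap.proj (R := ℝ) (φ := fun _ : Fin 2 => ℝ) 0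
        + β • ContinuousLinearMap.proj (R := ℝ) (φ := fun _ : Fin 2 => ℝ) 1)) q := fun q =>
    ((((hasFDerivAt_apply (0 : Fin 2) q).const_mul α).add
      ((hasFDerivAt_apply (1 : Fin 2) q).const_mul β)).neg).exp
  have hF := fun q => (hw q).hasFDerivAt.mul (hE q)
  have hconst := is_const_of_fderiv_eq_zero (𝕜 := ℝ) (fun q => (hF q).differentiableAt)
    (fun q => by
      rw [(hF q).fderiv]
      ext x
      simp [fderiv_apply_eq_pd w q, h0, h1]
      ring) p 0
  simp only [Pi.mul_apply, Pi.zero_apply, mul_zero, add_zero, neg_zero, exp_zero, mul_one]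
    at hconst
  rw [← hconst, mul_assoc, ← exp_add, neg_add_cancel, exp_zero, mul_one]

theorem hasFDerivAt_add_exp (a b c : ℝ) (p : Fin 2 → ℝ) :
    HasFDerivAt (fun q : Fin 2 → ℝ => a + b * exp (q 0) + c * exp (q 0 + q 1))
      (b • exp (p 0) • ContinuousLinearMap.proj (R := ℝ) (φ := fun _ : Fin 2 => ℝ) 0
        + c • exp (p 0 + p 1) • (ContinuousLinearMap.proj (R := ℝ) (φ := fun _ : Fin 2 => ℝ) 0
          + ContinuousLinearMap.proj (R := ℝ) (φ := fun _ : Fin 2 => ℝ) 1)) p :=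
  (((hasFDerivAt_apply (0 : Fin 2) p).exp.const_mul b).const_add a).add
    (((hasFDerivAt_apply (0 : Fin 2) p).add (hasFDerivAt_apply (1 : Fin 2) p)).exp.const_mul c)

theorem pd_zero_add_exp (a b c : ℝ) :
    pd (fun q => a + b * exp (q 0) + c * exp (q 0 + q 1)) 0 =
      fun q => 0 + b * exp (q 0) + c * exp (q 0 + q 1) := by
  ext p
  rw [pd, (hasFDerivAt_add_exp a b c p).fderiv]
  simp

theorem pd_one_add_exp (a b c : ℝ) :
    pd (fun q => a + b * exp (q 0) + c * exp (q 0 + q 1)) 1 =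
      fun q => 0 + 0 * exp (q 0) + c * exp (q 0 + q 1) := by
  ext p
  rw [pd, (hasFDerivAt_add_exp a b c p).fderiv]
  simp

theorem pd_const (c : ℝ) (i : Fin 2) : pd (fun _ => c) i = fun _ => 0 := by
  ext p
  simp [pd]

theorem stmt7 (T1 : ℝ) (hT : T1 ≠ 0)
    (v : Fin 2 → (Fin 2 → ℝ) → ℝ)
    (hv : ∀ i : Fin 2, ContDiff ℝ (⊤ : ℕ∞) (v i)) :
    IsAffineKilling Set.univ
      (fun i j k => fun _ : Fin 2 → ℝ =>
        ![![![(-1 : ℝ), 0], ![T1, 0]], ![![-T1, 0], ![0, 1]]] i j k) v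
    ↔ ∃ a b c d : ℝ, ∀ p : Fin 2 → ℝ,
        v 0 p = a + b * Real.exp (p 0) + c * Real.exp (p 0 + p 1)
        ∧ v 1 p = d := by
  constructor
  · intro h
    set f := v 0 with hf
    set g := v 1 with hg
    have cf : ContDiff ℝ (⊤ : ℕ∞) f := hv 0
    have cg : ContDiff ℝ (⊤ : ℕ∞) g := hv 1
    have K := fun i j k p => h i j k p (Set.mem_univ p)
    simp only [killingOp, pd_const, Fin.sum_univ_two, mul_zero, add_zero] at K
    have e000 := K 0 0 0
    have e010 := K 0 1 0
    have e100 := K 1 0 0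
    have e011 := K 0 1 1
    have e101 := K 1 0 1
    have e110 := K 1 1 0
    simp only [Matrix.cons_val_zero, Matrix.cons_val_one, ← hf, ← hg]
      at e000 e010 e100 e011 e101 e110
    have sf := pd_comm cf 0 1
    have sg := pd_comm cg 0 1
    have g0 : ∀ p, pd g 0 p = 0 := fun p => by
      have : T1 * pd g 0 p = 0 := by linarith [e011 p, e101 p, sg p]
      exact (mul_eq_zero.mp this).resolve_left hT
    have g1 : ∀ p, pd g 1 p = 0 := fun p => by
      have : T1 * pd g 1 p = 0 := by linarith [e010 p, e100 p, sf p]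
      exact (mul_eq_zero.mp this).resolve_left hT
    have f00 : ∀ p, pd (pd f 0) 0 p = pd f 0 p := fun p => by linarith [e000 p]
    have f10 : ∀ p, pd (pd f 1) 0 p = pd f 1 p := fun p => by
      have := e010 p
      rw [g1] at this
      linarith
    have f01 : ∀ p, pd (pd f 0) 1 p = pd f 1 p := fun p => by rw [sf, f10]
    have f11 : ∀ p, pd (pd f 1) 1 p = pd f 1 p := fun p => by linarith [e110 p]
    have df : Differentiable ℝ f := cf.differentiable (by simp)
    have df0 : Differentiable ℝ (pd f 0) := (cf.pd 0).differentiable (by simp)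
    have df1 : Differentiable ℝ (pd f 1) := (cf.pd 1).differentiable (by simp)
    have hA := eq_mul_exp_of_pd (df.sub df0) (α := 0) (β := 0)
      (fun p => by simp [Pi.sub_def, pd_sub df df0, f00])
      (fun p => by simp [Pi.sub_def, pd_sub df df0, f01])
    have hB := eq_mul_exp_of_pd (df0.sub df1) (α := 1) (β := 0)
      (fun p => by simp [Pi.sub_def, pd_sub df0 df1, f00, f10])
      (fun p => by simp [Pi.sub_def, pd_sub df0 df1, f01, f11])
    have hC := eq_mul_exp_of_pd df1 (α := 1) (β := 1) (by simpa using f10) (by simpa using f11)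
    have hD := eq_mul_exp_of_pd (cg.differentiable (by simp)) (α := 0) (β := 0)
      (by simpa using g0) (by simpa using g1)
    refine ⟨f 0 - pd f 0 0, pd f 0 0 - pd f 1 0, pd f 1 0, g 0, fun p => ⟨?_, ?_⟩⟩
    · have a := hA p
      have b := hB p
      have c := hC p
      simp only [Pi.sub_apply, zero_mul, one_mul, add_zero, exp_zero, mul_one] at a b c
      linarith
    · simpa using hD p
  · rintro ⟨a, b, c, d, h⟩ i j k p -
    have h0 : v 0 = fun q => a + b * exp (q 0) + c * exp (q 0 + q 1) := funext fun q => (h q).1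
    have h1 : v 1 = fun _ => d := funext fun q => (h q).2
    fin_cases i <;> fin_cases j <;> fin_cases k <;>
      simp [killingOp, h0, h1, pd_const, pd_zero_add_exp, pd_one_add_exp, -zero_add, -zero_mul] <;>
      ring
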